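/- Let B be a zero-sum-free commutative strong bimonoid or a zero-sum-free left-distributive strong bimonoid, let Γ be an alphabet, and let Σ be a ranked alphabet which is not trivial. Then the following two statements are equivalent: (1) for every weighted automaton A over Γ and B, supp(⟦A⟧^run) = supp(⟦A⟧^init); (2) for every weighted tree automaton A over Σ and B, supp(⟦A⟧^run) = supp(⟦A⟧^init). -/

import Mathlib

/-! Strong bimonoids -/

structure StrongBimonoid (B : Type) where
  add : B → B → B
  mul : B → B → B
  zero : B
  one : B
  add_assoc : ∀ a b c, add (add a b) c = add a (add b c)
  add_comm : ∀ a b, add a b = add b a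
  add_zero : ∀ a, add a zero = a
  mul_assoc : ∀ a b c, mul (mul a b) c = mul a (mul b c)
  one_mul : ∀ a, mul one a = a
  mul_one : ∀ a, mul a one = a
  zero_mul : ∀ a, mul zero a = zero
  mul_zero : ∀ a, mul a zero = zero

namespace StrongBimonoid

variable {B : Type} (S : StrongBimonoid B)

/-- The additive commutative monoid underlying a strong bimonoid. -/
def acm : AddCommMonoid B where
  add := S.add
  zero := S.zero
  add_assoc := S.add_assoc
  zero_add := fun a => (S.add_comm S.zero a).trans (S.add_zero a)
  add_zero := S.add_zero
  add_comm := S.add_comm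
  nsmul := fun n a => Nat.rec S.zero (fun _ ih => S.add ih a) n
  nsmul_zero := fun _ => rfl
  nsmul_succ := fun _ _ => rfl

/-- Finite sum (w.r.t. `S.add`, `S.zero`) of `f` over a finite index set. -/
def fsum {ι : Type} (t : Finset ι) (f : ι → B) : B :=
  @Finset.sum ι B S.acm t f

/-- Ordered product `f 0 ⊗ f 1 ⊗ ⋯ ⊗ f (k-1)` (empty product is `S.one`). -/
def finProd : {k : ℕ} → (Fin k → B) → B
  | 0, _ => S.one
  | _ + 1, f => S.mul (f 0) (finProd (fun i => f i.succ))

def ZeroSumFree : Prop :=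
  ∀ a b, S.add a b = S.zero → a = S.zero ∧ b = S.zero

def StronglyZeroSumFree : Prop :=
  ∀ a b c, S.mul (S.add a b) c = S.zero ↔ (S.mul a c = S.zero ∧ S.mul b c = S.zero)

def BiStronglyZeroSumFree : Prop :=
  ∀ a b b' c, S.mul (S.mul a (S.add b b')) c = S.zero ↔
    (S.mul (S.mul a b) c = S.zero ∧ S.mul (S.mul a b') c = S.zero)

def ZeroDivisorFree : Prop :=
  ∀ a b, S.mul a b = S.zero ↔ (a = S.zero ∨ b = S.zero)

def Positive : Prop := S.ZeroSumFree ∧ S.ZeroDivisorFree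

def RightDistributive : Prop :=
  ∀ a b c, S.mul (S.add a b) c = S.add (S.mul a c) (S.mul b c)

def LeftDistributive : Prop :=
  ∀ a b c, S.mul a (S.add b c) = S.add (S.mul a b) (S.mul a c)

def ZeroRightDistributive : Prop :=
  ∀ a b c, (S.mul (S.add a b) c = S.zero ↔ S.add (S.mul a c) (S.mul b c) = S.zero)

def CommutativeMul : Prop := ∀ a b, S.mul a b = S.mul b a

end StrongBimonoid

/-! Weighted automata over words -/

section Word

variable {B : Type} {Γ : Type} {Q : Type}

/-- The product `μ(a₁)_{ρ₀,ρ₁} ⊗ ⋯ ⊗ μ(aₙ)_{ρₙ₋₁,ρₙ}` of the transition weights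
along the run `ρ` on the word `w = a₁⋯aₙ`. -/
def transProd (S : StrongBimonoid B) (μ : Γ → Q → Q → B) :
    (w : List Γ) → (Fin (w.length + 1) → Q) → B
  | [], _ => S.one
  | a :: w, ρ => S.mul (μ a (ρ 0) (ρ 1)) (transProd S μ w (fun i => ρ i.succ))

/-- Run semantics of the weighted automaton `(Q, I, μ, F)` over `Γ` and `S`. -/
def runSem (S : StrongBimonoid B) [Fintype Q] (I : Q → B) (μ : Γ → Q → Q → B)
    (F : Q → B) (w : List Γ) : B :=
  S.fsum Finset.univ (fun ρ : Fin (w.length + 1) → Q =>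
    S.mul (S.mul (I (ρ 0)) (transProd S μ w ρ)) (F (ρ (Fin.last w.length))))

/-- `hWord S μ w v` is the vector `v ⊗ μ(a₁) ⊗ ⋯ ⊗ μ(aₙ)` (left-associated
vector-matrix products) for `w = a₁⋯aₙ`. -/
def hWord (S : StrongBimonoid B) [Fintype Q] (μ : Γ → Q → Q → B) :
    List Γ → (Q → B) → (Q → B)
  | [], v => v
  | a :: w, v =>
      hWord S μ w (fun q => S.fsum Finset.univ (fun p => S.mul (v p) (μ a p q)))

/-- Initial algebra semantics of the weighted automaton `(Q, I, μ, F)`. -/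
def initSem (S : StrongBimonoid B) [Fintype Q] (I : Q → B) (μ : Γ → Q → Q → B)
    (F : Q → B) (w : List Γ) : B :=
  S.fsum Finset.univ (fun q => S.mul (hWord S μ w I q) (F q))

end Word

/-! Ranked alphabets, trees and weighted tree automata -/

/-- Trees over the ranked alphabet `(σ, rk)`: a node labelled `s` has exactly
`rk s` children. -/
inductive RTree (σ : Type) (rk : σ → ℕ) : Type where
  | node (s : σ) (ts : Fin (rk s) → RTree σ rk) : RTree σ rk

/-- The ranked alphabet is trivial if all symbols have rank 0. -/
def RankTrivial {σ : Type} (rk : σ → ℕ) : Prop := ∀ s, rk s = 0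

/-- The ranked alphabet is branching if some symbol has rank ≥ 2. -/
def RankBranching {σ : Type} (rk : σ → ℕ) : Prop := ∃ s, 2 ≤ rk s

/-- A run of an automaton with state set `Q` on a tree: an assignment of a
state to every position of the tree. -/
inductive TreeRun (σ : Type) (rk : σ → ℕ) (Q : Type) : RTree σ rk → Type where
  | node {s : σ} {ts : Fin (rk s) → RTree σ rk} (q : Q)
      (rs : (i : Fin (rk s)) → TreeRun σ rk Q (ts i)) :
      TreeRun σ rk Q (RTree.node s ts)

/-- The state assigned by a run to the root. -/
def TreeRun.root {σ : Type} {rk : σ → ℕ} {Q : Type} {t : RTree σ rk} :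
    TreeRun σ rk Q t → Q
  | .node q _ => q

def treeRunFintype {σ : Type} {rk : σ → ℕ} (Q : Type) [Fintype Q] :
    (t : RTree σ rk) → Fintype (TreeRun σ rk Q t)
  | RTree.node s ts =>
    letI : ∀ i, Fintype (TreeRun σ rk Q (ts i)) := fun i => treeRunFintype Q (ts i)
    Fintype.ofEquiv (Q × ((i : Fin (rk s)) → TreeRun σ rk Q (ts i)))
      { toFun := fun p => TreeRun.node p.1 p.2
        invFun := fun r => match r with | TreeRun.node q rs => (q, rs)
        left_inv := fun _ => rfl
        right_inv := fun r => match r with | TreeRun.node _ _ => rfl }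

instance {σ : Type} {rk : σ → ℕ} {Q : Type} [Fintype Q] (t : RTree σ rk) :
    Fintype (TreeRun σ rk Q t) := treeRunFintype Q t

/-- The weight of a run on a tree. -/
def treeWt {B : Type} {σ : Type} {rk : σ → ℕ} {Q : Type} (S : StrongBimonoid B)
    (δ : (s : σ) → (Fin (rk s) → Q) → Q → B) :
    (t : RTree σ rk) → TreeRun σ rk Q t → B
  | _, TreeRun.node (s := s) (ts := ts) q rs =>
      S.mul (S.finProd (fun i => treeWt S δ (ts i) (rs i)))
        (δ s (fun i => (rs i).root) q)

/-- Run semantics of the weighted tree automaton `(Q, δ, F)`. -/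
def treeRunSem {B : Type} {σ : Type} {rk : σ → ℕ} {Q : Type} (S : StrongBimonoid B)
    [Fintype Q] (δ : (s : σ) → (Fin (rk s) → Q) → Q → B) (F : Q → B)
    (t : RTree σ rk) : B :=
  S.fsum Finset.univ (fun ρ : TreeRun σ rk Q t => S.mul (treeWt S δ t ρ) (F ρ.root))

/-- The map `h_A : T_Σ → B^Q` of the initial algebra semantics. -/
def treeH {B : Type} {σ : Type} {rk : σ → ℕ} {Q : Type} (S : StrongBimonoid B)
    [Fintype Q] (δ : (s : σ) → (Fin (rk s) → Q) → Q → B) :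
    RTree σ rk → Q → B
  | RTree.node s ts => fun q =>
      S.fsum Finset.univ (fun qs : Fin (rk s) → Q =>
        S.mul (S.finProd (fun i => treeH S δ (ts i) (qs i))) (δ s qs q))

/-- Initial algebra semantics of the weighted tree automaton `(Q, δ, F)`. -/
def treeInitSem {B : Type} {σ : Type} {rk : σ → ℕ} {Q : Type} (S : StrongBimonoid B)
    [Fintype Q] (δ : (s : σ) → (Fin (rk s) → Q) → Q → B) (F : Q → B)
    (t : RTree σ rk) : B :=
  S.fsum Finset.univ (fun q => S.mul (treeH S δ t q) (F q))


namespace StrongBimonoid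

variable {B : Type} (S : StrongBimonoid B)

theorem add_eq_zero_iff (hS : S.ZeroSumFree) (a b : B) :
    S.add a b = S.zero ↔ a = S.zero ∧ b = S.zero := by
  refine ⟨hS a b, ?_⟩
  rintro ⟨rfl, rfl⟩
  exact S.add_zero _

theorem fsum_empty {ι : Type} (f : ι → B) : S.fsum ∅ f = S.zero := by
  let := S.acm
  exact Finset.sum_empty

theorem fsum_insert {ι : Type} [DecidableEq ι] {t : Finset ι} {i : ι} (hi : i ∉ t) (f : ι → B) :
    S.fsum (insert i t) f = S.add (f i) (S.fsum t f) := by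
  let := S.acm
  exact Finset.sum_insert hi

theorem fsum_univ_eq_single {ι : Type} [Fintype ι] {f : ι → B} (i : ι)
    (h : ∀ j, j ≠ i → f j = S.zero) : S.fsum Finset.univ f = f i := by
  let := S.acm
  exact Fintype.sum_eq_single i h

theorem fsum_univ_eq_add {ι : Type} [Fintype ι] {f : ι → B} (i j : ι) (hij : i ≠ j)
    (h : ∀ x, x ≠ i ∧ x ≠ j → f x = S.zero) : S.fsum Finset.univ f = S.add (f i) (f j) := by
  let := S.acm
  exact Fintype.sum_eq_add i j hij h

theorem mul_fsum_mul_eq_zero_iff (hS : S.BiStronglyZeroSumFree) {ι : Type} (t : Finset ι)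
    (f : ι → B) (a c : B) :
    S.mul (S.mul a (S.fsum t f)) c = S.zero ↔ ∀ i ∈ t, S.mul (S.mul a (f i)) c = S.zero := by
  classical
  induction t using Finset.induction_on with
  | empty => simp [fsum_empty, S.mul_zero, S.zero_mul]
  | insert i t hi ih => rw [S.fsum_insert hi, hS, ih, Finset.forall_mem_insert]

theorem fsum_mul_eq_zero_iff (hS : S.StronglyZeroSumFree) {ι : Type} (t : Finset ι)
    (f : ι → B) (c : B) :
    S.mul (S.fsum t f) c = S.zero ↔ ∀ i ∈ t, S.mul (f i) c = S.zero := by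
  classical
  induction t using Finset.induction_on with
  | empty => simp [fsum_empty, S.zero_mul]
  | insert i t hi ih => rw [S.fsum_insert hi, hS, ih, Finset.forall_mem_insert]

theorem fsum_univ_eq_zero_iff (hS : S.ZeroSumFree) {ι : Type} [Fintype ι] (f : ι → B) :
    S.fsum Finset.univ f = S.zero ↔ ∀ i, f i = S.zero := by
  classical
  have key (t : Finset ι) : S.fsum t f = S.zero ↔ ∀ i ∈ t, f i = S.zero := by
    induction t using Finset.induction_on with
    | empty => simp [fsum_empty]
    | insert i t hi ih =>
      rw [S.fsum_insert hi, S.add_eq_zero_iff hS, ih, Finset.forall_mem_insert]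
  simpa using key Finset.univ

variable {S}

theorem StronglyZeroSumFree.bi (hS : S.StronglyZeroSumFree)
    (h : S.CommutativeMul ∨ S.LeftDistributive) : S.BiStronglyZeroSumFree := by
  intro a b b' c
  rcases h with h | h
  · rw [h a, h a, h a, S.mul_assoc, S.mul_assoc, S.mul_assoc]
    exact hS b b' _
  · rw [h]
    exact hS _ _ c

variable (S)

theorem finProd_eq_one {k : ℕ} (f : Fin k → B) (h : ∀ i, f i = S.one) : S.finProd f = S.one := by
  induction k with
  | zero => rfl
  | succ k ih =>
    rw [finProd, h, S.one_mul]
    exact ih _ fun i => h _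

theorem finProd_eq_head {k : ℕ} (hk : 0 < k) (f : Fin k → B)
    (h : ∀ i : Fin k, i.val ≠ 0 → f i = S.one) : S.finProd f = f ⟨0, hk⟩ := by
  cases k with
  | zero => exact absurd hk (lt_irrefl 0)
  | succ k =>
    rw [finProd, S.finProd_eq_one _ fun i => h i.succ (Nat.succ_ne_zero i), S.mul_one]
    rfl

/-- If each factor `f i` behaves, as far as annihilation is concerned, like the family `g i`,
then the product of the `f i` behaves like the family of products of the `g i`. -/
theorem mul_finProd_mul_eq_zero_iff {k : ℕ} {R : Fin k → Type} (f : Fin k → B)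
    (g : (i : Fin k) → R i → B)
    (h : ∀ i a c, S.mul (S.mul a (f i)) c = S.zero ↔ ∀ r, S.mul (S.mul a (g i r)) c = S.zero)
    (a c : B) :
    S.mul (S.mul a (S.finProd f)) c = S.zero ↔
      ∀ r : (i : Fin k) → R i, S.mul (S.mul a (S.finProd fun i => g i (r i))) c = S.zero := by
  induction k generalizing a with
  | zero => exact ⟨fun H _ => H, fun H => H fun i => i.elim0⟩
  | succ k ih =>
    have ih' := ih (fun i => f i.succ) (fun i => g i.succ) fun i => h i.succ
    have head (x : B) : S.mul (S.mul a (S.mul (f 0) x)) c = S.zero ↔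
        ∀ r, S.mul (S.mul (S.mul a (g 0 r)) x) c = S.zero := by
      have := h 0 a (S.mul x c)
      simpa only [S.mul_assoc] using this
    have tail (b : B) := ih' (S.mul a b)
    simp only [finProd]
    rw [head]
    simp only [tail]
    constructor
    · intro H r
      rw [← S.mul_assoc a]
      exact H (r 0) fun i => r i.succ
    · intro H r₀ r
      have := H (Fin.cons r₀ r)
      rw [← S.mul_assoc a] at this
      simpa using this

end StrongBimonoid

section Word

variable {B : Type} {Γ : Type} (S : StrongBimonoid B)

theorem hWord_mul_eq_zero_iff (hS : S.StronglyZeroSumFree) {Q : Type} [Fintype Q]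
    (μ : Γ → Q → Q → B) (F : Q → B) (w : List Γ) (v : Q → B) :
    (∀ q, S.mul (hWord S μ w v q) (F q) = S.zero) ↔
      ∀ ρ : Fin (w.length + 1) → Q,
        S.mul (S.mul (v (ρ 0)) (transProd S μ w ρ)) (F (ρ (Fin.last w.length))) = S.zero := by
  induction w generalizing v with
  | nil =>
    simp only [hWord, transProd, S.mul_one]
    exact ⟨fun H ρ => H _, fun H q => H fun _ => q⟩
  | cons a w ih =>
    rw [hWord, ih]
    simp only [S.mul_assoc, S.fsum_mul_eq_zero_iff hS, transProd]
    constructor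
    · intro H ρ
      exact H (fun i => ρ i.succ) (ρ 0) (Finset.mem_univ _)
    · intro H ρ p _
      exact H (Fin.cons p ρ : Fin (w.length + 1 + 1) → Q)

theorem runSem_eq_zero_iff_initSem (hz : S.ZeroSumFree) (hS : S.StronglyZeroSumFree)
    {Q : Type} [Fintype Q] (I : Q → B) (μ : Γ → Q → Q → B) (F : Q → B) (w : List Γ) :
    runSem S I μ F w = S.zero ↔ initSem S I μ F w = S.zero := by
  rw [runSem, initSem, S.fsum_univ_eq_zero_iff hz, S.fsum_univ_eq_zero_iff hz,
    hWord_mul_eq_zero_iff S hS]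

theorem stronglyZeroSumFree_of_runSem_eq_zero_iff [Nonempty Γ] (hz : S.ZeroSumFree)
    (h : ∀ (I : Bool → B) (μ : Γ → Bool → Bool → B) (F : Bool → B) (w : List Γ),
      runSem S I μ F w = S.zero ↔ initSem S I μ F w = S.zero) :
    S.StronglyZeroSumFree := by
  intro a b c
  obtain ⟨x⟩ := ‹Nonempty Γ›
  let I : Bool → B := fun q => cond q a b
  let μ : Γ → Bool → Bool → B := fun _ _ q => cond q S.one S.zero
  let F : Bool → B := fun q => cond q c S.zero
  have hinit : initSem S I μ F [x] = S.mul (S.add a b) c := by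
    rw [initSem, S.fsum_univ_eq_single true]
    · simp only [hWord]
      rw [S.fsum_univ_eq_add true false (by decide) (by rintro (_ | _) ⟨hx, hy⟩ <;> contradiction)]
      simp [I, μ, F, S.mul_one]
    · intro j hj
      obtain rfl : j = false := by simpa using hj
      exact S.mul_zero _
  rw [← hinit, ← h, runSem, S.fsum_univ_eq_zero_iff hz]
  have hrun (ρ : Fin ([x].length + 1) → Bool) :
      S.mul (S.mul (I (ρ 0)) (transProd S μ [x] ρ)) (F (ρ (Fin.last [x].length))) =
        cond (ρ 1) (S.mul (I (ρ 0)) c) S.zero := by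
    change S.mul (S.mul (I (ρ 0)) (S.mul (μ x (ρ 0) (ρ 1)) S.one)) (F (ρ 1)) = _
    cases ρ 1 <;> simp [μ, F, S.mul_one, S.mul_zero]
  simp only [hrun]
  constructor
  · intro H
    exact ⟨H fun _ => true, H fun i => decide (i ≠ 0)⟩
  · rintro ⟨ha, hb⟩ ρ
    cases ρ 1 <;> cases ρ 0 <;> simp [I, ha, hb]

end Word

section Tree

variable {B : Type} {σ : Type} {rk : σ → ℕ} (S : StrongBimonoid B)

theorem mul_treeH_mul_eq_zero_iff (hS : S.BiStronglyZeroSumFree) {Q : Type} [Fintype Q]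
    (δ : (s : σ) → (Fin (rk s) → Q) → Q → B) (t : RTree σ rk) (q : Q) (a c : B) :
    S.mul (S.mul a (treeH S δ t q)) c = S.zero ↔
      ∀ ρ : {ρ : TreeRun σ rk Q t // ρ.root = q},
        S.mul (S.mul a (treeWt S δ t ρ.1)) c = S.zero := by
  induction t generalizing q a c with
  | node s ts ih =>
    rw [treeH, S.mul_fsum_mul_eq_zero_iff hS]
    have children (qs : Fin (rk s) → Q) (d : B) :=
      S.mul_finProd_mul_eq_zero_iff (fun i => treeH S δ (ts i) (qs i))
        (fun i (ρ : {ρ : TreeRun σ rk Q (ts i) // ρ.root = qs i}) => treeWt S δ (ts i) ρ.1)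
        (fun i a c => ih i (qs i) a c) a (S.mul d c)
    simp only [S.mul_assoc] at children ⊢
    simp only [children]
    constructor
    · rintro H ⟨⟨q', rs⟩, rfl⟩
      rw [treeWt, S.mul_assoc]
      exact H (fun i => (rs i).root) (Finset.mem_univ _) fun i => ⟨rs i, rfl⟩
    · intro H qs _ r
      have := H ⟨.node q fun i => (r i).1, rfl⟩
      rw [treeWt, S.mul_assoc] at this
      simpa only [(r _).2] using this

theorem treeRunSem_eq_zero_iff_treeInitSem (hz : S.ZeroSumFree) (hS : S.BiStronglyZeroSumFree)
    {Q : Type} [Fintype Q] (δ : (s : σ) → (Fin (rk s) → Q) → Q → B) (F : Q → B)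
    (t : RTree σ rk) : treeRunSem S δ F t = S.zero ↔ treeInitSem S δ F t = S.zero := by
  rw [treeRunSem, treeInitSem, S.fsum_univ_eq_zero_iff hz, S.fsum_univ_eq_zero_iff hz]
  have key (q : Q) := mul_treeH_mul_eq_zero_iff S hS δ t q S.one (F q)
  simp only [S.one_mul] at key
  simp only [key]
  constructor
  · rintro H q ⟨ρ, rfl⟩
    exact H ρ
  · intro H ρ
    exact H ρ.root ⟨ρ, rfl⟩

theorem TreeRun.exists_eq_node {Q : Type} {s : σ} {ts : Fin (rk s) → RTree σ rk}
    (ρ : TreeRun σ rk Q (.node s ts)) :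
    ∃ (q : Q) (rs : (i : Fin (rk s)) → TreeRun σ rk Q (ts i)), ρ = .node q rs := by
  cases ρ with
  | node q rs => exact ⟨q, rs, rfl⟩

theorem treeWt_leaf {Q : Type} (δ : (s : σ) → (Fin (rk s) → Q) → Q → B) {s : σ}
    (hs : rk s = 0) (I : Q → B) (hI : ∀ qs q, δ s qs q = I q) (ts : Fin (rk s) → RTree σ rk)
    (ρ : TreeRun σ rk Q (.node s ts)) : treeWt S δ (.node s ts) ρ = I ρ.root := by
  have : IsEmpty (Fin (rk s)) := by rw [hs]; infer_instance
  cases ρ with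
  | node q rs => rw [treeWt, S.finProd_eq_one _ isEmptyElim, S.one_mul, hI]; rfl

theorem treeH_leaf {Q : Type} [Fintype Q] (δ : (s : σ) → (Fin (rk s) → Q) → Q → B) {s : σ}
    (hs : rk s = 0) (I : Q → B) (hI : ∀ qs q, δ s qs q = I q) (ts : Fin (rk s) → RTree σ rk)
    (q : Q) : treeH S δ (.node s ts) q = I q := by
  have : IsEmpty (Fin (rk s)) := by rw [hs]; infer_instance
  simp only [treeH]
  rw [S.fsum_univ_eq_single isEmptyElim fun j hj => absurd (Subsingleton.elim _ _) hj,
    S.finProd_eq_one _ isEmptyElim, S.one_mul, hI]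

theorem stronglyZeroSumFree_of_treeRunSem_eq_zero_iff (h0 : ∃ s, rk s = 0)
    (hnt : ¬ RankTrivial rk) (hz : S.ZeroSumFree)
    (h : ∀ (δ : (s : σ) → (Fin (rk s) → Option Bool) → Option Bool → B) (F : Option Bool → B)
      (t : RTree σ rk), treeRunSem S δ F t = S.zero ↔ treeInitSem S δ F t = S.zero) :
    S.StronglyZeroSumFree := by
  classical
  intro a b c
  obtain ⟨α, hα⟩ := h0
  obtain ⟨γ, hγ⟩ := not_forall.mp hnt
  have hγ' : 0 < rk γ := Nat.pos_of_ne_zero hγ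
  let I : Option Bool → B := fun q => q.elim S.one fun x => cond x a b
  let δ : (s : σ) → (Fin (rk s) → Option Bool) → Option Bool → B := fun s qs q =>
    if rk s = 0 then I q
    else if q = none ∧ ∀ i : Fin (rk s), (qs i).isSome ↔ i.val = 0 then S.one else S.zero
  let F : Option Bool → B := fun q => q.elim c fun _ => S.zero
  have hδα (qs q) : δ α qs q = I q := if_pos hα
  have hδγ (qs q) : δ γ qs q =
      if q = none ∧ ∀ i, (qs i).isSome ↔ i.val = 0 then S.one else S.zero := if_neg hγ
  let leaf : RTree σ rk := .node α fun i => (i.cast hα).elim0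
  let t : RTree σ rk := .node γ fun _ => leaf
  let g : (Fin (rk γ) → Option Bool) → B := fun qs =>
    S.mul (S.finProd fun i => I (qs i)) (δ γ qs none)
  let choice : Bool → Fin (rk γ) → Option Bool := fun x i => if i.val = 0 then some x else none
  have hg_choice (x : Bool) : g (choice x) = cond x a b := by
    have h1 : δ γ (choice x) none = S.one := by
      rw [hδγ, if_pos]
      refine ⟨rfl, fun i => ?_⟩
      by_cases hi : i.val = 0 <;> simp [choice, hi]
    change S.mul _ _ = _
    rw [h1, S.mul_one, S.finProd_eq_head hγ' _ fun i hi => by simp [choice, hi, I]]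
    simp [choice, I]
  have hg_zero (qs : Fin (rk γ) → Option Bool) (hqs : ∀ x, qs ≠ choice x) : g qs = S.zero := by
    have h1 : δ γ qs none = S.zero := by
      rw [hδγ, if_neg]
      rintro ⟨-, H⟩
      obtain ⟨x, hx⟩ := Option.isSome_iff_exists.mp ((H ⟨0, hγ'⟩).mpr rfl)
      refine hqs x (funext fun i => ?_)
      by_cases hi : i.val = 0
      · obtain rfl : i = ⟨0, hγ'⟩ := Fin.ext hi
        simp [choice, hx]
      · have : (qs i).isSome = false := by simpa using mt (H i).mp hi
        simpa [choice, hi] using this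
    change S.mul _ _ = _
    rw [h1, S.mul_zero]
  have hne : choice true ≠ choice false := fun H => by
    simpa [choice] using congrFun H ⟨0, hγ'⟩
  have hleaf (q) : treeH S δ leaf q = I q := treeH_leaf S δ hα I hδα _ q
  have hinit : treeInitSem S δ F t = S.mul (S.add a b) c := by
    have h1 : treeH S δ t none = S.fsum Finset.univ g := by
      have h2 : treeH S δ t none = S.fsum Finset.univ fun qs : Fin (rk γ) → Option Bool =>
          S.mul (S.finProd fun i => treeH S δ leaf (qs i)) (δ γ qs none) := by
        rw [treeH]
      simp only [h2, hleaf, g]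
    rw [treeInitSem, S.fsum_univ_eq_single none, h1,
      S.fsum_univ_eq_add (choice true) (choice false) hne fun qs hqs =>
        hg_zero qs (by simpa using hqs.symm),
      hg_choice, hg_choice]
    · rfl
    · rintro (_ | x) hx
      · exact absurd rfl hx
      · exact S.mul_zero _
  have hwt (rs : (i : Fin (rk γ)) → TreeRun σ rk (Option Bool) leaf) :
      treeWt S δ t (.node none rs) = g fun i => (rs i).root := by
    simp only [t, treeWt, g]
    congr 2
    funext i
    exact treeWt_leaf S δ hα I hδα _ (rs i)
  rw [← hinit, ← h, treeRunSem, S.fsum_univ_eq_zero_iff hz]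
  constructor
  · intro H
    have H' (x : Bool) : S.mul (cond x a b) c = S.zero := by
      have := H (.node none fun i => .node (choice x i) fun j => (j.cast hα).elim0)
      rw [hwt] at this
      rw [← hg_choice x]
      exact this
    exact ⟨H' true, H' false⟩
  · rintro ⟨ha, hb⟩ ρ
    obtain ⟨_ | y, rs, rfl⟩ := ρ.exists_eq_node
    · rw [hwt]
      by_cases hx : ∃ x, (fun i => (rs i).root) = choice x
      · obtain ⟨x, hx⟩ := hx
        rw [hx, hg_choice]
        cases x
        · exact hb
        · exact ha
      · rw [hg_zero _ (not_exists.mp hx), S.zero_mul]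
    · exact S.mul_zero _

end Tree

theorem stmt19 {B : Type} (S : StrongBimonoid B) (hzsf : S.ZeroSumFree)
    (hcl : S.CommutativeMul ∨ S.LeftDistributive)
    (Γ : Type) [Fintype Γ] [Nonempty Γ]
    (σt : Type) [Fintype σt] [Nonempty σt] (rk : σt → ℕ) (h0 : ∃ s, rk s = 0)
    (hnt : ¬ RankTrivial rk) :
    (∀ (Q : Type) [Fintype Q] [Nonempty Q] (I : Q → B) (μ : Γ → Q → Q → B) (F : Q → B),
      {w : List Γ | runSem S I μ F w ≠ S.zero} =
        {w : List Γ | initSem S I μ F w ≠ S.zero}) ↔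
    (∀ (Q : Type) [Fintype Q] [Nonempty Q] (δ : (s : σt) → (Fin (rk s) → Q) → Q → B) (F : Q → B),
      {t : RTree σt rk | treeRunSem S δ F t ≠ S.zero} =
        {t : RTree σt rk | treeInitSem S δ F t ≠ S.zero}) := by
  have setOf_ne_eq {X : Type} (f g : X → B) :
      {x | f x ≠ S.zero} = {x | g x ≠ S.zero} ↔ ∀ x, f x = S.zero ↔ g x = S.zero := by
    simp only [Set.ext_iff, Set.mem_ofPred_eq, not_iff_not, ne_eq]
  simp only [setOf_ne_eq]
  constructor
  · intro h Q _ _ δ F t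
    have hS := stronglyZeroSumFree_of_runSem_eq_zero_iff S hzsf fun I μ F => h Bool I μ F
    exact treeRunSem_eq_zero_iff_treeInitSem S hzsf (hS.bi hcl) δ F t
  · intro h Q _ _ I μ F w
    have hS := stronglyZeroSumFree_of_treeRunSem_eq_zero_iff S h0 hnt hzsf
      fun δ F => h (Option Bool) δ F
    exact runSem_eq_zero_iff_initSem S hzsf hS I μ F w
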